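/- Under the RA model (W row-stochastic but not necessarily irreducible): up to a null set, the event that x_t converges to a consensus vector x_∞ ∈ {𝟘, 𝟙} (the all-zeros or all-ones vector of [0,1]^N) coincides with the event that the almost-surely-existing limits of the subvectors (x_{t,i})_{i∈C}, taken over all maximal communication classes C, are all equal to the same value (all all-zeros or all all-ones). In particular, the RA model converges to consensus almost surely if and only if almost surely all maximal classes converge to the same value. -/

import Mathlib

open MeasureTheory ProbabilityTheory Filter

namespace RA

variable {Ω : Type*}

/-- History σ-algebra generated by `x 1, …, x t` and `a 1, …, a (t-1)`. -/
def hist {N : ℕ} [MeasurableSpace Ω] (x a : ℕ → Ω → Fin N → ℝ) (t : ℕ) :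
    MeasurableSpace Ω :=
  (⨆ s ∈ Finset.Icc 1 t, MeasurableSpace.comap (x s) inferInstance) ⊔
  (⨆ s ∈ Finset.Ico 1 t, MeasurableSpace.comap (a s) inferInstance)

/-- The Random Actions (RA) opinion dynamics model. -/
structure IsRAModel {N : ℕ} [MeasurableSpace Ω] (μ : Measure Ω) (α : ℝ)
    (W : Matrix (Fin N) (Fin N) ℝ) (x a : ℕ → Ω → Fin N → ℝ) : Prop where
  isProb : IsProbabilityMeasure μ
  alpha_mem : α ∈ Set.Ioo (0 : ℝ) 1
  W_nonneg : ∀ i j, 0 ≤ W i j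
  W_rowsum : ∀ i, ∑ j, W i j = 1
  x_meas : ∀ t, Measurable (x t)
  a_meas : ∀ t, Measurable (a t)
  x_mem : ∀ t, 1 ≤ t → ∀ ω i, x t ω i ∈ Set.Icc (0 : ℝ) 1
  a_mem : ∀ t, 1 ≤ t → ∀ ω i, a t ω i = 0 ∨ a t ω i = 1
  update : ∀ t, 1 ≤ t → ∀ ω i,
    x (t + 1) ω i = (1 - α) * x t ω i + α * ∑ j, W i j * a t ω j
  bernoulli : ∀ t, 1 ≤ t → ∀ b : Fin N → Bool, ∀ H : Set Ω,
    MeasurableSet[hist x a t] H →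
    (μ (H ∩ {ω | ∀ i, a t ω i = if b i then (1 : ℝ) else 0})).toReal
      = ∫ ω in H, ∏ i, (if b i then x t ω i else 1 - x t ω i) ∂μ

/-- `W` is irreducible: the network is strongly connected. -/
def Irreducible {N : ℕ} (W : Matrix (Fin N) (Fin N) ℝ) : Prop :=
  ∀ i j, ∃ n : ℕ, 0 < (W ^ n) i j

/-- The event that `x t i ∈ [0,δ) ∪ (1-δ,1]`. -/
def cti {N : ℕ} (x : ℕ → Ω → Fin N → ℝ) (δ : ℝ) (t : ℕ) (i : Fin N) : Set Ω :=
  {ω | x t ω i < δ ∨ 1 - δ < x t ω i}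

def ct {N : ℕ} (x : ℕ → Ω → Fin N → ℝ) (δ : ℝ) (t : ℕ) : Set Ω :=
  ⋂ i, cti x δ t i

def c0 {N : ℕ} (x : ℕ → Ω → Fin N → ℝ) (δ : ℝ) (t : ℕ) (i : Fin N) : Set Ω :=
  {ω | x t ω i < δ}

def c1 {N : ℕ} (x : ℕ → Ω → Fin N → ℝ) (δ : ℝ) (t : ℕ) (i : Fin N) : Set Ω :=
  {ω | 1 - δ < x t ω i}

/-- The event that every coordinate of `x t` is within `δ` of `0`. -/
def corner0 {N : ℕ} (x : ℕ → Ω → Fin N → ℝ) (δ : ℝ) (t : ℕ) : Set Ω :=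
  {ω | ∀ i, x t ω i < δ}

/-- The event that every coordinate of `x t` is within `δ` of `1`. -/
def corner1 {N : ℕ} (x : ℕ → Ω → Fin N → ℝ) (δ : ℝ) (t : ℕ) : Set Ω :=
  {ω | ∀ i, 1 - δ < x t ω i}

/-- Agents `i` and `j` communicate. -/
def Communicates {N : ℕ} (W : Matrix (Fin N) (Fin N) ℝ) (i j : Fin N) : Prop :=
  (∃ n : ℕ, 0 < (W ^ n) j i) ∧ (∃ n : ℕ, 0 < (W ^ n) i j)

/-- `C` is a communication class (strongly connected component). -/
def CommClass {N : ℕ} (W : Matrix (Fin N) (Fin N) ℝ) (C : Set (Fin N)) : Prop :=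
  ∃ i, C = {j | Communicates W i j}

/-- `C` is a maximal communication class: no agent outside `C` has a directed
path into `C`. -/
def IsMaximalClass {N : ℕ} (W : Matrix (Fin N) (Fin N) ℝ) (C : Set (Fin N)) : Prop :=
  CommClass W C ∧ ∀ i ∈ C, ∀ j, (∃ n : ℕ, 0 < (W ^ n) i j) → j ∈ C

theorem exists_pos_le_prod_one_sub {u : ℕ → ℝ} (hu : ∀ k, 0 ≤ u k) (hu1 : ∀ k, u k < 1)
    (hs : Summable u) : ∃ p, 0 < p ∧ ∀ n, p ≤ ∏ k ∈ Finset.range n, (1 - u k) := by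
  have hs' : Summable fun k => ‖-u k‖ := by simpa using hs.norm
  have hlim : Tendsto (fun n => ∏ k ∈ Finset.range n, (1 - u k)) atTop
      (nhds (∏' k, (1 + -u k))) := by
    simpa [sub_eq_add_neg] using (multipliable_one_add_of_summable hs').hasProd.tendsto_prod_nat
  have hne : ∏' k, (1 + -u k) ≠ 0 :=
    tprod_one_add_ne_zero_of_summable (fun k => by have := hu1 k; linarith) hs'
  have hnn : 0 ≤ ∏' k, (1 + -u k) := ge_of_tendsto' hlim fun n =>
    Finset.prod_nonneg fun k _ => by have := hu1 k; linarith
  have hanti : Antitone fun n => ∏ k ∈ Finset.range n, (1 - u k) := by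
    refine antitone_nat_of_succ_le fun n => ?_
    rw [Finset.prod_range_succ]
    refine mul_le_of_le_one_right (Finset.prod_nonneg fun k _ => ?_) ?_
    · have := hu1 k; linarith
    · have := hu n; linarith
  exact ⟨_, hnn.lt_of_ne' hne, fun n => hanti.le_of_tendsto hlim n⟩

/-- A positive lower bound on the conditional probability of `s` given a sub-σ-algebra. -/
theorem ae_const_le_condExp_indicator {Ω : Type*} {m m0 : MeasurableSpace Ω} {μ : Measure Ω}
    [IsFiniteMeasure μ] (hm : m ≤ m0) {A s : Set Ω} (hA : MeasurableSet[m] A)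
    (hs : MeasurableSet s) {p : ℝ}
    (h : ∀ H, MeasurableSet[m] H → H ⊆ A → p * μ.real H ≤ μ.real (H ∩ s)) :
    ∀ᵐ ω ∂μ, ω ∈ A → p ≤ (μ[s.indicator (fun _ => (1 : ℝ)) | m]) ω := by
  set f := μ[s.indicator (fun _ => (1 : ℝ)) | m] with hf
  have hfm : Measurable[m] f := stronglyMeasurable_condExp.measurable
  set H := A ∩ {ω | f ω < p} with hH
  have hHm : MeasurableSet[m] H := hA.inter (measurableSet_lt hfm measurable_const)
  have hint : ∫ ω in H, f ω ∂μ = μ.real (H ∩ s) := by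
    rw [hf, setIntegral_condExp hm ((integrable_const 1).indicator hs) hHm,
      setIntegral_indicator hs]
    simp
  have hle : ∫ ω in H, (p - f ω) ∂μ ≤ 0 := by
    rw [integral_sub (integrable_const _) integrable_condExp.integrableOn, hint]
    have := h H hHm Set.inter_subset_left
    simp [mul_comm] at this ⊢
    linarith
  have hnn : 0 ≤ᵐ[μ.restrict H] fun ω => p - f ω := by
    filter_upwards [ae_restrict_mem (hm _ hHm)] with ω hω
    have := hω.2
    simp only [Set.mem_ofPred_eq] at this
    simp; linarith
  have hz := (setIntegral_eq_zero_iff_of_nonneg_ae hnn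
    ((integrable_const _).sub integrable_condExp).integrableOn).1
    (le_antisymm hle (integral_nonneg_of_ae hnn))
  rw [EventuallyEq, ae_restrict_iff' (hm _ hHm)] at hz
  filter_upwards [hz] with ω hω hωA
  by_contra hlt
  push Not at hlt
  have := hω ⟨hωA, hlt⟩
  simp at this
  linarith

theorem integrable_prod_unitInterval {ι : Type*} [Fintype ι] {m : MeasurableSpace Ω}
    {μ : Measure Ω} [IsFiniteMeasure μ] {g : ι → Ω → ℝ} (hg : ∀ i, Measurable (g i))
    (h01 : ∀ i ω, g i ω ∈ Set.Icc (0 : ℝ) 1) : Integrable (fun ω => ∏ i, g i ω) μ := by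
  refine Integrable.of_bound (C := 1)
    (Finset.measurable_fun_prod _ fun i _ => hg i).aestronglyMeasurable (.of_forall fun ω => ?_)
  rw [Real.norm_eq_abs, abs_of_nonneg (Finset.prod_nonneg fun i _ => (h01 i ω).1)]
  exact Finset.prod_le_one (fun i _ => (h01 i ω).1) fun i _ => (h01 i ω).2

theorem hist_le {m : MeasurableSpace Ω} [MeasurableSpace Ω] {N : ℕ}
    {x a : ℕ → Ω → Fin N → ℝ} {t : ℕ}
    (hx : ∀ s, 1 ≤ s → s ≤ t → Measurable[m] (x s))
    (ha : ∀ s, 1 ≤ s → s < t → Measurable[m] (a s)) : hist x a t ≤ m :=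
  sup_le
    (iSup₂_le fun s hs => (hx s (Finset.mem_Icc.1 hs).1 (Finset.mem_Icc.1 hs).2).comap_le)
    (iSup₂_le fun s hs => (ha s (Finset.mem_Ico.1 hs).1 (Finset.mem_Ico.1 hs).2).comap_le)

section History

variable [MeasurableSpace Ω] {N : ℕ} {x a : ℕ → Ω → Fin N → ℝ}

theorem hist_mono : Monotone (hist x a) := fun _ _ h =>
  sup_le_sup (biSup_mono fun _ hs => Finset.Icc_subset_Icc_right h hs)
    (biSup_mono fun _ hs => Finset.Ico_subset_Ico_right h hs)

theorem measurable_state_hist {s t : ℕ} (hs : 1 ≤ s) (hst : s ≤ t) :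
    Measurable[hist x a t] (x s) :=
  Measurable.mono (comap_measurable (x s))
    ((le_biSup (fun s => MeasurableSpace.comap (x s) inferInstance)
      (Finset.mem_Icc.2 ⟨hs, hst⟩)).trans le_sup_left) le_rfl

theorem measurable_action_hist {s t : ℕ} (hs : 1 ≤ s) (hst : s < t) :
    Measurable[hist x a t] (a s) :=
  Measurable.mono (comap_measurable (a s))
    ((le_biSup (fun s => MeasurableSpace.comap (a s) inferInstance)
      (Finset.mem_Ico.2 ⟨hs, hst⟩)).trans le_sup_right) le_rfl

end History

section Model

variable [MeasurableSpace Ω] {N : ℕ} {μ : Measure Ω} {α : ℝ} {W : Matrix (Fin N) (Fin N) ℝ}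
  {x a : ℕ → Ω → Fin N → ℝ}

theorem IsRAModel.hist_le (h : IsRAModel μ α W x a) (t : ℕ) : hist x a t ≤ ‹MeasurableSpace Ω› :=
  RA.hist_le (fun s _ _ => h.x_meas s) (fun s _ _ => h.a_meas s)

/-- Exchanging the roles of the two actions gives another RA model. -/
theorem IsRAModel.reflect (h : IsRAModel μ α W x a) :
    IsRAModel μ α W (fun t ω i => 1 - x t ω i) (fun t ω i => 1 - a t ω i) where
  isProb := h.isProb
  alpha_mem := h.alpha_mem
  W_nonneg := h.W_nonneg
  W_rowsum := h.W_rowsum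
  x_meas t := by have := h.x_meas t; fun_prop
  a_meas t := by have := h.a_meas t; fun_prop
  x_mem t ht ω i := by
    have := h.x_mem t ht ω i
    constructor <;> linarith [this.1, this.2]
  a_mem t ht ω i := by
    rcases h.a_mem t ht ω i with h | h <;> simp [h]
  update t ht ω i := by
    simp only [h.update t ht ω i, mul_sub, Finset.sum_sub_distrib, mul_one, h.W_rowsum i]
    ring
  bernoulli t ht b H hH := by
    have hle : hist (fun t ω i => 1 - x t ω i) (fun t ω i => 1 - a t ω i) t ≤ hist x a t := by
      refine RA.hist_le (fun s h1 h2 => ?_) (fun s h1 h2 => ?_)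
      · exact (show Measurable fun y : Fin N → ℝ => fun i => 1 - y i by fun_prop).comp
          (measurable_state_hist h1 h2)
      · exact (show Measurable fun y : Fin N → ℝ => fun i => 1 - y i by fun_prop).comp
          (measurable_action_hist h1 h2)
    have hset : {ω | ∀ i, 1 - a t ω i = if b i then (1 : ℝ) else 0}
        = {ω | ∀ i, a t ω i = if !b i then (1 : ℝ) else 0} := by
      ext ω
      refine forall_congr' fun i => ?_
      rcases h.a_mem t ht ω i with h | h <;> cases b i <;> simp [h]
    rw [hset, h.bernoulli t ht (fun i => !b i) H (hle _ hH)]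
    congr 1
    ext ω
    refine Finset.prod_congr rfl fun i _ => ?_
    cases b i <;> simp

/-- Agents that are unlikely to act have a good conditional chance of not acting all together. -/
theorem IsRAModel.le_measureReal_inter_inactive (h : IsRAModel μ α W x a) {t : ℕ} (ht : 1 ≤ t)
    (S : Set (Fin N)) {u : ℝ} (hu0 : 0 ≤ u) (hu1 : u ≤ 1) {H : Set Ω}
    (hH : MeasurableSet[hist x a t] H) (hHu : ∀ ω ∈ H, ∀ i ∈ S, x t ω i ≤ u) :
    (1 - u) ^ N * μ.real H ≤ μ.real (H ∩ {ω | ∀ i ∈ S, a t ω i = 0}) := by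
  classical
  have := h.isProb
  have hHm : MeasurableSet H := h.hist_le t _ hH
  let T : Fin N → Finset Bool := fun i => if i ∈ S then {false} else Finset.univ
  let E : (Fin N → Bool) → Set Ω := fun b => H ∩ {ω | ∀ i, a t ω i = if b i then (1 : ℝ) else 0}
  have hEm (b) : MeasurableSet (E b) := by
    refine hHm.inter ?_
    have := h.a_meas t
    simp only [Set.ofPred_forall]
    exact MeasurableSet.iInter fun i => measurableSet_eq_fun (by fun_prop) measurable_const
  have hunion : H ∩ {ω | ∀ i ∈ S, a t ω i = 0} = ⋃ b ∈ Fintype.piFinset T, E b := by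
    ext ω
    simp only [Set.mem_inter_iff, Set.mem_iUnion, E, exists_prop]
    constructor
    · rintro ⟨hω, h0⟩
      refine ⟨fun i => decide (a t ω i = 1), Fintype.mem_piFinset.2 fun i => ?_, hω, fun i => ?_⟩
      · by_cases hi : i ∈ S
        · simp [T, hi, h0 i hi]
        · simp [T, hi, em]
      · rcases h.a_mem t ht ω i with h | h <;> simp [h]
    · rintro ⟨b, hb, hω, hab⟩
      refine ⟨hω, fun i hi => ?_⟩
      have := Fintype.mem_piFinset.1 hb i
      simp only [T, hi, if_true, Finset.mem_singleton] at this
      simpa [this] using hab i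
  have hdisj : Set.PairwiseDisjoint (↑(Fintype.piFinset T)) E := by
    intro b _ b' _ hbb
    refine Set.disjoint_left.2 fun ω h1 h2 => hbb (funext fun i => ?_)
    have h1i := h1.2 i
    have h2i := h2.2 i
    rw [h1i] at h2i
    cases hb : b i <;> cases hb' : b' i <;> simp_all
  have hxm : Measurable (x t) := h.x_meas t
  have hbd (b : Fin N → Bool) :
      Integrable (fun ω => ∏ i, (if b i then x t ω i else 1 - x t ω i)) μ := by
    refine integrable_prod_unitInterval (fun i => ?_) fun i ω => ?_
    · split_ifs <;> fun_prop
    · have := h.x_mem t ht ω i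
      split_ifs <;> constructor <;> linarith [this.1, this.2]
  have hsum : μ.real (H ∩ {ω | ∀ i ∈ S, a t ω i = 0})
      = ∫ ω in H, ∏ i, (if i ∈ S then 1 - x t ω i else 1) ∂μ := by
    rw [hunion, measureReal_biUnion_finset hdisj fun b _ => hEm b]
    calc _ = ∑ b ∈ Fintype.piFinset T,
          ∫ ω in H, ∏ i, (if b i then x t ω i else 1 - x t ω i) ∂μ :=
          Finset.sum_congr rfl fun b _ => h.bernoulli t ht b H hH
      _ = ∫ ω in H, ∑ b ∈ Fintype.piFinset T, ∏ i, (if b i then x t ω i else 1 - x t ω i) ∂μ :=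
          (integral_finsetSum _ fun b _ => (hbd b).integrableOn).symm
      _ = _ := by
          congr 1
          ext ω
          rw [← Finset.prod_univ_sum T fun i b => if b then x t ω i else 1 - x t ω i]
          refine Finset.prod_congr rfl fun i _ => ?_
          by_cases hi : i ∈ S <;> simp [T, hi]
  have hconst : (1 - u) ^ N * μ.real H = ∫ _ in H, (1 - u) ^ N ∂μ := by
    simp [mul_comm]
  rw [hsum, hconst]
  refine setIntegral_mono_on (integrable_const _).integrableOn ?_ hHm fun ω hω => ?_
  · refine (integrable_prod_unitInterval (fun i => ?_) fun i ω => ?_).integrableOn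
    · split_ifs <;> fun_prop
    · have := h.x_mem t ht ω i
      split_ifs <;> constructor <;> linarith [this.1, this.2]
  · calc (1 - u) ^ N = ∏ _i : Fin N, (1 - u) := by simp
      _ ≤ _ := by
        refine Finset.prod_le_prod (fun _ _ => by linarith) fun i _ => ?_
        split_ifs with hi
        · linarith [hHu ω hω i hi]
        · linarith

end Model

section Dynamics

variable [MeasurableSpace Ω] {N : ℕ} {μ : Measure Ω} {α : ℝ} {W : Matrix (Fin N) (Fin N) ℝ}
  {x a : ℕ → Ω → Fin N → ℝ}

/-- The agents reached from `R` along directed paths with at most `k` edges. -/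
def influenced (W : Matrix (Fin N) (Fin N) ℝ) (R : Set (Fin N)) (k : ℕ) : Set (Fin N) :=
  {i | ∃ m ≤ k, ∃ j ∈ R, 0 < (W ^ m) i j}

theorem influenced_mono (W : Matrix (Fin N) (Fin N) ℝ) (R : Set (Fin N)) :
    Monotone (influenced W R) :=
  fun _ _ hkl _ ⟨m, hm, hR⟩ => ⟨m, hm.trans hkl, hR⟩

theorem influenced_zero_subset (W : Matrix (Fin N) (Fin N) ℝ) (R : Set (Fin N)) :
    influenced W R 0 ⊆ R := by
  rintro i ⟨m, hm, j, hj, h⟩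
  obtain rfl : m = 0 := by omega
  by_cases hij : i = j
  · exact hij ▸ hj
  · simp [hij] at h

theorem mem_influenced_succ (hW : ∀ i j, 0 ≤ W i j) {R : Set (Fin N)} {k : ℕ} {i : Fin N}
    (hi : i ∈ influenced W R (k + 1)) :
    i ∈ influenced W R k ∨ ∃ l ∈ influenced W R k, 0 < W i l := by
  obtain ⟨m, hm, j, hj, h⟩ := hi
  rcases m with _ | m
  · exact .inl ⟨0, k.zero_le, j, hj, h⟩
  · rw [pow_succ', Matrix.mul_apply] at h
    obtain ⟨l, -, hl⟩ := Finset.exists_lt_of_sum_lt (f := fun _ => (0 : ℝ)) (by simpa using h)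
    have hWl : 0 < W i l := (hW i l).lt_of_ne fun h0 => by simp [← h0] at hl
    exact .inr ⟨l, ⟨m, by omega, j, hj, pos_of_mul_pos_right hl (hW i l)⟩, hWl⟩

/-- Bounds for the beliefs of influenced agents: they decrease below `1` while the inactivity
spreads during the first `K` steps, and geometrically afterwards. -/
noncomputable def beliefBound (α c : ℝ) (K k : ℕ) : ℝ :=
  (1 - α) ^ (k - K) * (1 - c ^ (min k K + 1))

theorem beliefBound_nonneg {α c : ℝ} (hα : α ∈ Set.Ioo (0 : ℝ) 1) (hc : c ∈ Set.Ioo (0 : ℝ) 1)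
    (K k : ℕ) : 0 ≤ beliefBound α c K k :=
  mul_nonneg (pow_nonneg (by linarith [hα.2]) _)
    (sub_nonneg.2 (pow_le_one₀ hc.1.le hc.2.le))

theorem beliefBound_lt_one {α c : ℝ} (hα : α ∈ Set.Ioo (0 : ℝ) 1) (hc : c ∈ Set.Ioo (0 : ℝ) 1)
    (K k : ℕ) : beliefBound α c K k < 1 := by
  have h1 : (1 - α) ^ (k - K) ≤ 1 := pow_le_one₀ (by linarith [hα.2]) (by linarith [hα.1])
  have h2 : 0 < c ^ (min k K + 1) := pow_pos hc.1 _
  have h3 : c ^ (min k K + 1) ≤ 1 := pow_le_one₀ hc.1.le hc.2.le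
  unfold beliefBound
  nlinarith

theorem summable_beliefBound {α c : ℝ} (hα : α ∈ Set.Ioo (0 : ℝ) 1) (K : ℕ) :
    Summable (beliefBound α c K) := by
  rw [← summable_nat_add_iff K]
  have : (fun k => beliefBound α c K (k + K)) = fun k => (1 - α) ^ k * (1 - c ^ (K + 1)) := by
    ext k
    simp [beliefBound]
  rw [this]
  exact (summable_geometric_of_lt_one (by linarith [hα.2]) (by linarith [hα.1])).mul_right _

/-- One step of the dynamics preserves the bounds, if influenced agents remain inactive. -/
theorem IsRAModel.le_beliefBound_succ (h : IsRAModel μ α W x a) {R : Set (Fin N)} {c : ℝ} {K : ℕ}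
    (hc : c ∈ Set.Ioo (0 : ℝ) 1) (hcα : c ≤ 1 - α) (hcW : ∀ i j, 0 < W i j → c ≤ α * W i j)
    (hK : influenced W R K = Set.univ) {s k : ℕ} (hs : 1 ≤ s) {ω : Ω}
    (hx : ∀ i ∈ influenced W R k, x s ω i ≤ beliefBound α c K k)
    (ha : ∀ i ∈ influenced W R k, a s ω i = 0) :
    ∀ i ∈ influenced W R (k + 1), x (s + 1) ω i ≤ beliefBound α c K (k + 1) := by
  intro i hi
  have hα := h.alpha_mem
  rw [h.update s hs ω i]
  rcases lt_or_ge k K with hkK | hKk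
  · have hb : beliefBound α c K k = 1 - c ^ (k + 1) := by
      simp [beliefBound, Nat.sub_eq_zero_of_le hkK.le, hkK.le]
    have hb' : beliefBound α c K (k + 1) = 1 - c ^ (k + 2) := by
      simp [beliefBound, Nat.sub_eq_zero_of_le hkK, Nat.succ_le_of_lt hkK]
    have hck : 0 < c ^ (k + 1) := pow_pos hc.1 _
    have hck1 : c ^ (k + 1) ≤ 1 := pow_le_one₀ hc.1.le hc.2.le
    have hle (j) : W i j * a s ω j ≤ W i j := by
      have := h.W_nonneg i j
      rcases h.a_mem s hs ω j with h | h <;> simp [h, this]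
    rw [hb', pow_succ c (k + 1)]
    rcases mem_influenced_succ h.W_nonneg hi with hi | ⟨l, hl, hil⟩
    · have h1 := hx i hi
      rw [hb] at h1
      have h2 : ∑ j, W i j * a s ω j ≤ 1 :=
        (Finset.sum_le_sum fun j _ => hle j).trans_eq (h.W_rowsum i)
      nlinarith [hα.1, hα.2]
    · have h1 := (h.x_mem s hs ω i).2
      have h2 : ∑ j, W i j * a s ω j ≤ 1 - W i l := by
        rw [← h.W_rowsum i, ← Finset.add_sum_erase _ _ (Finset.mem_univ l),
          ← Finset.add_sum_erase _ (W i) (Finset.mem_univ l), ha l hl, mul_zero, zero_add,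
          add_sub_cancel_left]
        exact Finset.sum_le_sum fun j _ => hle j
      have h3 := hcW i l hil
      nlinarith [hα.1, hα.2, hc.1]
  · have huniv : influenced W R k = Set.univ :=
      Set.eq_univ_of_univ_subset (hK ▸ influenced_mono W R hKk)
    have hb : beliefBound α c K (k + 1) = (1 - α) * beliefBound α c K k := by
      simp [beliefBound, hKk, Nat.succ_sub hKk, hKk.trans k.le_succ, pow_succ', mul_assoc]
    have h0 (j) : a s ω j = 0 := ha j (huniv ▸ Set.mem_univ j)
    have h1 := hx i (huniv ▸ Set.mem_univ i)
    simp only [h0, mul_zero, Finset.sum_const_zero, add_zero, hb]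
    exact mul_le_mul_of_nonneg_left h1 (by linarith [hα.2])

/-- Once the agents of `R` have belief at most `1/2`, consensus at `0` has conditional probability
bounded below, provided every agent is reached from `R`. -/
theorem IsRAModel.exists_le_measureReal_inter_tendsto_zero (h : IsRAModel μ α W x a)
    {R : Set (Fin N)} (hR : ∀ i, ∃ j ∈ R, ∃ n : ℕ, 0 < (W ^ n) i j) :
    ∃ p, 0 < p ∧ ∀ t, 1 ≤ t → ∀ H, MeasurableSet[hist x a t] H →
      H ⊆ {ω | ∀ i ∈ R, x t ω i ≤ 1 / 2} →
      p * μ.real H ≤ μ.real (H ∩ {ω | ∀ i, Tendsto (fun s => x s ω i) atTop (nhds 0)}) := by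
  have := h.isProb
  have hα := h.alpha_mem
  obtain ⟨K, hK⟩ : ∃ K, influenced W R K = Set.univ := by
    choose j hj n hn using hR
    exact ⟨Finset.univ.sup n, Set.eq_univ_of_forall fun i =>
      ⟨n i, Finset.le_sup (Finset.mem_univ i), j i, hj i, hn i⟩⟩
  obtain ⟨c, hc0, hc2, hcα, hcW⟩ : ∃ c : ℝ, 0 < c ∧ c ≤ 1 / 2 ∧ c ≤ 1 - α ∧
      ∀ i j, 0 < W i j → c ≤ α * W i j := by
    have hev {b : ℝ} (hb : 0 < b) : ∀ᶠ c in nhdsWithin (0 : ℝ) (Set.Ioi 0), c ≤ b :=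
      mem_nhdsWithin_of_mem_nhds (Iic_mem_nhds hb)
    refine ((eventually_mem_nhdsWithin (a := (0 : ℝ))).and ((hev one_half_pos).and
      ((hev (by linarith [hα.2])).and ?_))).exists
    refine eventually_all.2 fun i => eventually_all.2 fun j => ?_
    by_cases hW : 0 < W i j
    · filter_upwards [hev (mul_pos hα.1 hW)] with c hc _ using hc
    · exact .of_forall fun _ h => absurd h hW
  have hc : c ∈ Set.Ioo (0 : ℝ) 1 := ⟨hc0, by linarith⟩
  set u := beliefBound α c K with hu
  have hu0 := beliefBound_nonneg hα hc K
  have hu1 := beliefBound_lt_one hα hc K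
  have hus := summable_beliefBound (c := c) hα K
  obtain ⟨p, hp, hple⟩ := exists_pos_le_prod_one_sub hu0 hu1 hus
  refine ⟨p ^ N, pow_pos hp N, fun t ht H hH hHR => ?_⟩
  let G : ℕ → Set Ω := fun n => H ∩ {ω | ∀ k < n, ∀ i ∈ influenced W R k, a (t + k) ω i = 0}
  have hG_succ (n) : G (n + 1) = G n ∩ {ω | ∀ i ∈ influenced W R n, a (t + n) ω i = 0} := by
    ext ω
    simp only [G, Set.mem_inter_iff, Set.mem_ofPred_eq, Nat.forall_lt_succ_right, and_assoc]
  have hG_meas (n) : MeasurableSet[hist x a (t + n)] (G n) := by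
    induction n with
    | zero => simpa [G] using hH
    | succ n ih =>
      rw [hG_succ]
      refine (hist_mono (by omega) _ ih).inter ?_
      have : Measurable[hist x a (t + (n + 1))] (a (t + n)) :=
        measurable_action_hist (by omega) (by omega)
      simp only [Set.ofPred_forall]
      refine MeasurableSet.iInter fun i => MeasurableSet.iInter fun _ => ?_
      exact (measurable_pi_apply i).comp this (measurableSet_singleton 0)
  have hG_le (n) : ∀ ω ∈ G n, ∀ i ∈ influenced W R n, x (t + n) ω i ≤ u n := by
    induction n with
    | zero =>
      intro ω hω i hi
      have := hHR hω.1 i (influenced_zero_subset W R hi)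
      simp [hu, beliefBound] at this ⊢
      linarith
    | succ n ih =>
      intro ω hω
      rw [hG_succ] at hω
      exact h.le_beliefBound_succ (s := t + n) hc hcα hcW hK (by omega) (ih ω hω.1) hω.2
  have hG_prob (n) : (∏ k ∈ Finset.range n, (1 - u k)) ^ N * μ.real H ≤ μ.real (G n) := by
    induction n with
    | zero => simp [G]
    | succ n ih =>
      rw [Finset.prod_range_succ, mul_pow, hG_succ]
      refine le_trans ?_ (h.le_measureReal_inter_inactive (t := t + n) (by omega)
        (influenced W R n) (hu0 n) (hu1 n).le (hG_meas n) (hG_le n))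
      have := mul_le_mul_of_nonneg_left ih (pow_nonneg (sub_nonneg.2 (hu1 n).le) N)
      linarith
  have hG_anti : Antitone G := antitone_nat_of_succ_le fun n => by
    rw [hG_succ]
    exact Set.inter_subset_left
  have hlim : Tendsto (fun n => μ.real (G n)) atTop (nhds (μ.real (⋂ n, G n))) :=
    (ENNReal.tendsto_toReal (measure_ne_top _ _)).comp (tendsto_measure_iInter_atTop
      (fun n => (h.hist_le _ _ (hG_meas n)).nullMeasurableSet) hG_anti ⟨0, measure_ne_top _ _⟩)
  refine (ge_of_tendsto' hlim fun n => le_trans ?_ (hG_prob n)).trans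
    (measureReal_mono fun ω hω => ?_)
  · exact mul_le_mul_of_nonneg_right (pow_le_pow_left₀ hp.le (hple n) N) measureReal_nonneg
  · rw [Set.mem_iInter] at hω
    refine ⟨(hω 0).1, fun i => (tendsto_add_atTop_iff_nat t).1 ?_⟩
    refine tendsto_of_tendsto_of_tendsto_of_le_of_le' tendsto_const_nhds
      hus.tendsto_atTop_zero (.of_forall fun n => (h.x_mem (n + t) (by omega) ω i).1) ?_
    filter_upwards [eventually_ge_atTop K] with n hn
    rw [add_comm]
    exact hG_le n ω (hω n) i (influenced_mono W R hn (hK ▸ Set.mem_univ i))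

/-- Almost surely, convergence to `0` of a set of agents that reaches every agent forces
convergence of all agents to `0`. -/
theorem IsRAModel.ae_tendsto_zero_of_reaching (h : IsRAModel μ α W x a)
    {R : Set (Fin N)} (hR : ∀ i, ∃ j ∈ R, ∃ n : ℕ, 0 < (W ^ n) i j) :
    ∀ᵐ ω ∂μ, (∀ i ∈ R, Tendsto (fun t => x t ω i) atTop (nhds 0)) →
      ∀ i, Tendsto (fun t => x t ω i) atTop (nhds 0) := by
  have := h.isProb
  obtain ⟨p, hp, hple⟩ := h.exists_le_measureReal_inter_tendsto_zero hR
  set s := {ω | ∀ i, Tendsto (fun t => x t ω i) atTop (nhds 0)} with hs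
  let F : Filtration ℕ ‹MeasurableSpace Ω› :=
    ⟨fun n => hist x a (n + 1), fun _ _ hmn => hist_mono (by omega), fun n => h.hist_le _⟩
  have hs_meas : MeasurableSet[⨆ n, F n] s := by
    have hs' : s = ⋂ i, {ω | Tendsto (fun n => x (n + 1) ω i) atTop (nhds 0)} := by
      ext ω
      simp only [hs, Set.mem_ofPred_eq, Set.mem_iInter]
      exact forall_congr' fun i => (tendsto_add_atTop_iff_nat (f := fun n => x n ω i) 1).symm
    rw [hs']
    refine MeasurableSet.iInter fun i => measurableSet_tendsto _ fun n => ?_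
    have : Measurable[F n] (x (n + 1)) := measurable_state_hist (by omega) le_rfl
    exact ((measurable_pi_apply i).comp this).mono (le_iSup F n) le_rfl
  have hs_meas' : MeasurableSet s := iSup_le (fun n => F.le n) _ hs_meas
  have hlevy := ((integrable_const (1 : ℝ)).indicator hs_meas').tendsto_ae_condExp (μ := μ)
    (ℱ := F) (stronglyMeasurable_const.indicator hs_meas)
  have hlow : ∀ᵐ ω ∂μ, ∀ n, (∀ i ∈ R, x (n + 1) ω i ≤ 1 / 2) →
      p ≤ (μ[s.indicator (fun _ => (1 : ℝ)) | F n]) ω := by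
    refine ae_all_iff.2 fun n => ?_
    refine ae_const_le_condExp_indicator (A := {ω | ∀ i ∈ R, x (n + 1) ω i ≤ 1 / 2}) (F.le n) ?_
      hs_meas' (hple (n + 1) (by omega))
    have : Measurable[F n] (x (n + 1)) := measurable_state_hist (by omega) le_rfl
    simp only [Set.ofPred_forall]
    refine MeasurableSet.iInter fun i => MeasurableSet.iInter fun _ => ?_
    exact (measurable_pi_apply i).comp this measurableSet_Iic
  filter_upwards [hlevy, hlow] with ω hω hlow hRω
  by_contra hωs
  have hev : ∀ᶠ n in atTop, ∀ i ∈ R, x (n + 1) ω i ≤ 1 / 2 :=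
    (eventually_all.2 fun i => eventually_imp_distrib_left.2 fun hi =>
      (tendsto_add_atTop_nat 1).eventually ((hRω i hi).eventually_le_const one_half_pos))
  have hple0 : p ≤ s.indicator (fun _ => (1 : ℝ)) ω :=
    ge_of_tendsto hω (hev.mono fun n hn => hlow n hn)
  rw [Set.indicator_of_notMem (s := s) hωs] at hple0
  linarith

end Dynamics

theorem exists_pow_pos_trans {N : ℕ} {W : Matrix (Fin N) (Fin N) ℝ} (hW : ∀ i j, 0 ≤ W i j)
    {i j k : Fin N} (hij : ∃ n : ℕ, 0 < (W ^ n) i j) (hjk : ∃ n : ℕ, 0 < (W ^ n) j k) :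
    ∃ n : ℕ, 0 < (W ^ n) i k := by
  obtain ⟨m, hm⟩ := hij
  obtain ⟨n, hn⟩ := hjk
  have hpow (r : ℕ) : ∀ i j, 0 ≤ (W ^ r) i j := by
    induction r with
    | zero => intro i j; simp only [pow_zero, Matrix.one_apply]; split_ifs <;> norm_num
    | succ r ih =>
      intro i j
      rw [pow_succ, Matrix.mul_apply]
      exact Finset.sum_nonneg fun l _ => mul_nonneg (ih i l) (hW l j)
  refine ⟨m + n, ?_⟩
  rw [pow_add, Matrix.mul_apply]
  exact Finset.sum_pos' (fun l _ => mul_nonneg (hpow m i l) (hpow n l k))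
    ⟨j, Finset.mem_univ j, mul_pos hm hn⟩

/-- Every agent is reached from some maximal class. -/
theorem exists_isMaximalClass_reaching {N : ℕ} {W : Matrix (Fin N) (Fin N) ℝ}
    (hW : ∀ i j, 0 ≤ W i j) (i : Fin N) :
    ∃ C, IsMaximalClass W C ∧ ∃ j ∈ C, ∃ n : ℕ, 0 < (W ^ n) i j := by
  classical
  let reach : Fin N → Fin N → Prop := fun i j => ∃ n : ℕ, 0 < (W ^ n) i j
  have hrefl (j) : reach j j := ⟨0, by simp⟩
  let S : Fin N → Finset (Fin N) := fun j => {l | reach j l}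
  obtain ⟨j, hj, hmin⟩ := (S i).exists_min_image (fun j => (S j).card) ⟨i, by simp [S, hrefl]⟩
  have hij : reach i j := by simpa [S] using hj
  have hback (l) (hjl : reach j l) : reach l j := by
    have hsub : S l ⊆ S j := fun k hk => by
      simp only [S, Finset.mem_filter_univ] at hk ⊢
      exact exists_pow_pos_trans hW hjl hk
    have heq := Finset.eq_of_subset_of_card_le hsub
      (hmin l (by simpa [S] using exists_pow_pos_trans hW hij hjl))
    have : j ∈ S l := heq ▸ (by simp [S, hrefl])
    simpa [S] using this
  refine ⟨{l | Communicates W j l}, ⟨⟨j, rfl⟩, fun l hl k hlk => ?_⟩, j, ⟨hrefl j, hrefl j⟩, hij⟩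
  have hjk := exists_pow_pos_trans hW hl.2 hlk
  exact ⟨hback k hjk, hjk⟩

theorem consensus_iff_maximal_classes_agree {Ω : Type*} [MeasurableSpace Ω] {N : ℕ} (hN : 1 ≤ N)
    (μ : Measure Ω) (α : ℝ) (W : Matrix (Fin N) (Fin N) ℝ)
    (x a : ℕ → Ω → Fin N → ℝ) (hRA : IsRAModel μ α W x a) :
    μ (symmDiff
        {ω | (∀ i, Filter.Tendsto (fun t => x t ω i) Filter.atTop (nhds 0))
            ∨ (∀ i, Filter.Tendsto (fun t => x t ω i) Filter.atTop (nhds 1))}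
        {ω | (∀ C : Set (Fin N), IsMaximalClass W C →
                ∀ i ∈ C, Filter.Tendsto (fun t => x t ω i) Filter.atTop (nhds 0))
            ∨ (∀ C : Set (Fin N), IsMaximalClass W C →
                ∀ i ∈ C, Filter.Tendsto (fun t => x t ω i) Filter.atTop (nhds 1))}) = 0
    ∧ (μ {ω | (∀ i, Filter.Tendsto (fun t => x t ω i) Filter.atTop (nhds 0))
            ∨ (∀ i, Filter.Tendsto (fun t => x t ω i) Filter.atTop (nhds 1))} = 1
        ↔ μ {ω | (∀ C : Set (Fin N), IsMaximalClass W C →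
                ∀ i ∈ C, Filter.Tendsto (fun t => x t ω i) Filter.atTop (nhds 0))
            ∨ (∀ C : Set (Fin N), IsMaximalClass W C →
                ∀ i ∈ C, Filter.Tendsto (fun t => x t ω i) Filter.atTop (nhds 1))} = 1) := by
  set R : Set (Fin N) := {i | ∃ C, IsMaximalClass W C ∧ i ∈ C}
  have hR (i) : ∃ j ∈ R, ∃ n : ℕ, 0 < (W ^ n) i j := by
    obtain ⟨C, hC, j, hj, hij⟩ := exists_isMaximalClass_reaching hRA.W_nonneg i
    exact ⟨j, ⟨C, hC, hj⟩, hij⟩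
  have hzero := hRA.ae_tendsto_zero_of_reaching hR
  have hone := hRA.reflect.ae_tendsto_zero_of_reaching hR
  have hiff (ω : Ω) (i : Fin N) : Tendsto (fun t => 1 - x t ω i) atTop (nhds 0)
      ↔ Tendsto (fun t => x t ω i) atTop (nhds 1) :=
    ⟨fun h => by simpa using h.const_sub 1, fun h => by simpa using h.const_sub 1⟩
  have := hRA.isProb
  rw [measure_symmDiff_eq_zero_iff]
  refine (fun hae => ⟨hae, by rw [measure_congr hae]⟩) (eventuallyEq_set.2 ?_)
  filter_upwards [hzero, hone] with ω h0 h1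
  simp only [hiff] at h1
  constructor
  · rintro (h | h)
    · exact .inl fun _ _ i _ => h i
    · exact .inr fun _ _ i _ => h i
  · rintro (h | h)
    · exact .inl (h0 fun i ⟨C, hC, hi⟩ => h C hC i hi)
    · exact .inr (h1 fun i ⟨C, hC, hi⟩ => h C hC i hi)

end RA
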